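/- Let k be a field and A a commutative k-algebra. Then the following are equivalent: (1) for every finite separable field extension k'/k, the algebra A ⊗_k k' has no idempotents other than 0 and 1; (2) every k-subalgebra B of A which is a finite étale k-algebra (i.e., finite-dimensional over k and formally étale, equivalently a finite product of finite separable field extensions of k) is equal to the image of k in A. -/

import Mathlib

open scoped TensorProduct

universe u

open TensorProduct

theorem IsArtinianRing.isField_of_forall_isIdempotentElem (R : Type*) [CommRing R] [Nontrivial R]
    [IsArtinianRing R] [IsReduced R] (h : ∀ e : R, IsIdempotentElem e → e = 0 ∨ e = 1) :
    IsField R where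
  exists_pair_ne := exists_pair_ne R
  mul_comm := mul_comm
  mul_inv_cancel {x} hx := by
    have := IsArtinianRing.isSemisimpleRing_of_isReduced R
    obtain ⟨e, he, hxe⟩ := IsSemisimpleRing.ideal_eq_span_idempotent (Ideal.span {x})
    rcases h e he with rfl | rfl
    · exact absurd (by simpa using hxe) hx
    · rw [Ideal.span_singleton_one, Ideal.span_singleton_eq_top] at hxe
      exact hxe.exists_right_inv

namespace Algebra

namespace FormallyUnramified

section elem

variable (R S : Type*) [CommRing R] [CommRing S] [Algebra R S] [EssFiniteType R S]
  [FormallyUnramified R S]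

theorem mul_elem (x : S ⊗[R] S) :
    x * elem R S = (TensorProduct.lmul' R x ⊗ₜ 1) * elem R S := by
  induction x with
  | zero => simp
  | add x y hx hy => rw [add_mul, hx, hy, map_add, add_tmul, add_mul]
  | tmul a b =>
    have hab : a ⊗ₜ[R] b = (a ⊗ₜ 1) * (1 ⊗ₜ b) := by simp
    rw [hab, mul_assoc, one_tmul_mul_elem, ← mul_assoc]
    simp

theorem isIdempotentElem_elem : IsIdempotentElem (elem R S) := by
  rw [IsIdempotentElem, mul_elem, lmul_elem, ← Algebra.TensorProduct.one_def, one_mul]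

theorem lmul'_injective_of_elem_eq_one (h : elem R S = 1) :
    Function.Injective (TensorProduct.lmul' R : S ⊗[R] S →ₐ[R] S) := by
  intro x y hxy
  have := mul_elem R S x
  rwa [hxy, ← mul_elem, h, mul_one, mul_one] at this

end elem

/-- An algebra generated by idempotents is formally unramified. -/
theorem of_adjoin_eq_top_of_isIdempotentElem {R S : Type*} [CommRing R] [CommRing S] [Algebra R S]
    (s : Set S) (hs : Algebra.adjoin R s = ⊤) (h : ∀ e ∈ s, IsIdempotentElem e) :
    FormallyUnramified R S := by
  have hD : KaehlerDifferential.D R S = 0 := by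
    refine Derivation.ext_of_adjoin_eq_top s hs fun e he ↦ ?_
    set d := KaehlerDifferential.D R S e with hd
    have h1 : e • d + e • d = d := by
      rw [hd, ← Derivation.leibniz, (h e he).eq]
    have h2 : e • d = 0 := by
      have := congrArg (e • ·) h1
      simpa [smul_smul, (h e he).eq] using this
    rw [h2, add_zero] at h1
    simpa using h1.symm
  refine ⟨(Submodule.subsingleton_iff S).mp (subsingleton_of_bot_eq_top ?_)⟩
  rw [← KaehlerDifferential.span_range_derivation, hD, eq_comm, Submodule.span_eq_bot]
  rintro _ ⟨x, rfl⟩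
  rfl

theorem adjoin_of_isIdempotentElem {R S : Type*} [CommRing R] [CommRing S] [Algebra R S]
    (s : Set S) (h : ∀ e ∈ s, IsIdempotentElem e) :
    FormallyUnramified R (Algebra.adjoin R s) :=
  of_adjoin_eq_top_of_isIdempotentElem (((↑) : Algebra.adjoin R s → S) ⁻¹' s)
    Algebra.adjoin_adjoin_coe_preimage fun e he ↦ Subtype.ext (h e he)

end FormallyUnramified

/-- A finite reduced algebra over a perfect field is formally étale. -/
theorem FormallyEtale.of_isReduced_of_perfectField (K C : Type u) [Field K] [PerfectField K]
    [CommRing C] [Algebra K C] [Module.Finite K C] [IsReduced C] : FormallyEtale K C := by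
  have : IsArtinianRing C := .of_finite K C
  let _ (m : MaximalSpectrum C) : Field (C ⧸ m.asIdeal) := Ideal.Quotient.field m.asIdeal
  exact FormallyEtale.iff_exists_algEquiv_prod K C |>.mpr
    ⟨MaximalSpectrum C, inferInstance, fun m ↦ C ⧸ m.asIdeal, inferInstance, inferInstance,
      (IsArtinianRing.equivPi C).restrictScalars K, fun m ↦ inferInstance⟩

end Algebra

open Algebra

/-- The coefficients of an element of `A ⊗[k] L`, after base change to an algebraically closed
field `K`, are `K`-linear combinations of the images of the element under the embeddings of `L`
in `K`. -/
theorem one_tmul_repr_mem_span_range_map {k A L K ι : Type*} [Field k] [CommRing A] [Algebra k A]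
    [Field L] [Algebra k L] [FiniteDimensional k L] [Algebra.IsSeparable k L]
    [Field K] [Algebra k K] [IsAlgClosed K] [Fintype ι] (b : Module.Basis ι k L)
    (e : A ⊗[k] L) (i : ι) :
    (1 : K) ⊗ₜ[k] (Algebra.TensorProduct.basis A b).repr e i ∈ Submodule.span K
      (Set.range fun σ : L →ₐ[k] K ↦
        Algebra.TensorProduct.comm k A K (Algebra.TensorProduct.map (AlgHom.id k A) σ e)) := by
  classical
  set a := (Algebra.TensorProduct.basis A b).repr e with ha
  have he : e = ∑ i, a i ⊗ₜ[k] b i := by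
    rw [← (Algebra.TensorProduct.basis A b).sum_repr e]
    simp [ha, TensorProduct.smul_tmul']
  have hcard : Fintype.card ι = Fintype.card (L →ₐ[k] K) := by
    rw [AlgHom.card, Module.finrank_eq_card_basis b]
  let f : ι ≃ (L →ₐ[k] K) := Fintype.equivOfCardEq hcard
  let M := Algebra.embeddingsMatrixReindex k K b f
  have hM : IsUnit M.det := by
    have := Algebra.discr_eq_det_embeddingsMatrixReindex_pow_two k K b f
    rw [isUnit_iff_ne_zero, ← pow_ne_zero_iff two_ne_zero, ← this]
    exact (map_ne_zero _).mpr (Algebra.discr_not_zero_of_basis k b)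
  have hσ (j : ι) : Algebra.TensorProduct.comm k A K
      (Algebra.TensorProduct.map (AlgHom.id k A) (f j) e) = ∑ i, M i j ⊗ₜ[k] a i := by
    simp [he, M, Algebra.embeddingsMatrixReindex, Algebra.embeddingsMatrix_apply]
  have key : (1 : K) ⊗ₜ[k] a i = ∑ j, M⁻¹ j i • Algebra.TensorProduct.comm k A K
      (Algebra.TensorProduct.map (AlgHom.id k A) (f j) e) := by
    simp_rw [hσ, Finset.smul_sum, TensorProduct.smul_tmul', smul_eq_mul]
    rw [Finset.sum_comm]
    simp_rw [← TensorProduct.sum_tmul, mul_comm (M⁻¹ _ _), ← Matrix.mul_apply,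
      Matrix.mul_nonsing_inv M hM, Matrix.one_apply]
    simp [ite_tmul]
  rw [key]
  exact Submodule.sum_mem _ fun j _ ↦ Submodule.smul_mem _ _ (Submodule.subset_span ⟨f j, rfl⟩)

/-- The subalgebra generated by the coefficients of an idempotent of `A ⊗[k] L` is finite étale. -/
theorem finite_and_formallyEtale_adjoin_repr {k A L ι : Type u} [Field k] [CommRing A]
    [Algebra k A] [Field L] [Algebra k L] [FiniteDimensional k L] [Algebra.IsSeparable k L]
    [Finite ι] (b : Module.Basis ι k L) {e : A ⊗[k] L} (he : IsIdempotentElem e) :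
    FiniteDimensional k
        (Algebra.adjoin k (Set.range ((Algebra.TensorProduct.basis A b).repr e))) ∧
      FormallyEtale k
        (Algebra.adjoin k (Set.range ((Algebra.TensorProduct.basis A b).repr e))) := by
  have := Fintype.ofFinite ι
  set a := (Algebra.TensorProduct.basis A b).repr e
  set B := Algebra.adjoin k (Set.range a)
  let K := AlgebraicClosure k
  let g (σ : L →ₐ[k] K) : K ⊗[k] A :=
    Algebra.TensorProduct.comm k A K (Algebra.TensorProduct.map (AlgHom.id k A) σ e)
  let C := Algebra.adjoin K (Set.range g)
  have hC : FormallyUnramified K C := by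
    refine FormallyUnramified.adjoin_of_isIdempotentElem _ ?_
    rintro _ ⟨σ, rfl⟩
    exact (he.map _).map _
  have : Algebra.FiniteType K C :=
    .adjoin_of_finite (Set.finite_range g)
  have : Module.Finite K C := FormallyUnramified.finite_of_free K C
  have : IsReduced C := FormallyUnramified.isReduced_of_field K C
  have hB : B ≤ (C.restrictScalars k).comap Algebra.TensorProduct.includeRight := by
    refine Algebra.adjoin_le ?_
    rintro _ ⟨i, rfl⟩
    exact Algebra.span_le_adjoin K _ (one_tmul_repr_mem_span_range_map b e i)
  let φ : K ⊗[k] B →ₐ[K] K ⊗[k] A := Algebra.TensorProduct.map (AlgHom.id K K) B.val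
  have hφ : Function.Injective φ :=
    Module.Flat.lTensor_preserves_injective_linearMap B.val.toLinearMap Subtype.val_injective
  have hφC (x : K ⊗[k] B) : φ x ∈ C := by
    induction x with
    | zero => simp
    | add x y hx hy => simpa using C.add_mem hx hy
    | tmul c y =>
      have : φ (c ⊗ₜ y) = c • ((1 : K) ⊗ₜ[k] (y : A)) := by simp [φ, TensorProduct.smul_tmul']
      rw [this]
      exact C.smul_mem (hB y.2) c
  let ψ : K ⊗[k] B →ₐ[K] C := φ.codRestrict C hφC
  have hψ : Function.Injective ψ := (AlgHom.injective_codRestrict _ _ _).mpr hφ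
  have : Module.Finite K (K ⊗[k] B) := Module.Finite.of_injective ψ.toLinearMap hψ
  have : IsReduced (K ⊗[k] B) := isReduced_of_injective ψ hψ
  have : FormallyEtale K (K ⊗[k] B) := .of_isReduced_of_perfectField K _
  have : FormallyUnramified k B :=
    .of_formallyUnramified_tensorProduct_of_faithfullyFlat K
  have : Algebra.FiniteType k B :=
    .adjoin_of_finite (Set.finite_range a)
  exact ⟨FormallyUnramified.finite_of_free k B, .of_formallyUnramified_of_field k B⟩

/-- If `A ⊗[k] L` has only trivial idempotents, then the only copy of `L` in `A` is `k`. -/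
theorem AlgHom.range_eq_bot_of_forall_isIdempotentElem {k A L : Type*} [Field k] [CommRing A]
    [Algebra k A] [Field L] [Algebra k L] [FiniteDimensional k L] [Algebra.IsSeparable k L]
    (f : L →ₐ[k] A) (h : ∀ e : A ⊗[k] L, IsIdempotentElem e → e = 0 ∨ e = 1) :
    f.range = ⊥ := by
  cases subsingleton_or_nontrivial A
  · exact Subsingleton.elim _ _
  have := FormallyUnramified.of_isSeparable k L
  let F : L ⊗[k] L →ₐ[k] A ⊗[k] L := Algebra.TensorProduct.map f (AlgHom.id k L)
  have hF : Function.Injective F :=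
    Module.Flat.rTensor_preserves_injective_linearMap f.toLinearMap f.toRingHom.injective
  have hone : FormallyUnramified.elem k L = 1 := by
    rcases h _ ((FormallyUnramified.isIdempotentElem_elem k L).map F) with h0 | h1
    · have := FormallyUnramified.lmul_elem (R := k) (S := L)
      rw [hF (h0.trans (map_zero F).symm), map_zero] at this
      exact absurd this zero_ne_one
    · exact hF (h1.trans (map_one F).symm)
  have hle := LinearMap.finrank_le_finrank_of_injective
    (f := (Algebra.TensorProduct.lmul' k : L ⊗[k] L →ₐ[k] L).toLinearMap)
    (FormallyUnramified.lmul'_injective_of_elem_eq_one k L hone)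
  rw [Module.finrank_tensorProduct] at hle
  have hpos : 0 < Module.finrank k L := Module.finrank_pos
  have hrank : Module.finrank k L = 1 := by nlinarith
  rw [← Algebra.map_top, ← Subalgebra.bot_eq_top_iff_finrank_eq_one.mpr hrank, Algebra.map_bot]

/-- For a commutative algebra `A` over a field `k`, the following are equivalent:
(1) for every finite separable field extension `k'/k` the algebra `A ⊗_k k'` has no
nontrivial idempotents; (2) every `k`-subalgebra of `A` which is a finite étale
`k`-algebra (finite-dimensional and formally étale over `k`) is trivial, i.e. equal
to the image `⊥` of `k` in `A`. -/
theorem no_idempotents_iff_no_nontrivial_etale_subalgebra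
    (k : Type u) [Field k] (A : Type u) [CommRing A] [Algebra k A] :
    (∀ (k' : Type u) [Field k'] [Algebra k k'] [FiniteDimensional k k']
        [Algebra.IsSeparable k k'],
        ∀ e : A ⊗[k] k', IsIdempotentElem e → e = 0 ∨ e = 1) ↔
      (∀ B : Subalgebra k A, FiniteDimensional k B → Algebra.FormallyEtale k B →
        B = ⊥) := by
  constructor
  · intro h B _ _
    cases subsingleton_or_nontrivial A
    · exact Subsingleton.elim _ _
    have hA (e : A) (he : IsIdempotentElem e) : e = 0 ∨ e = 1 := by
      let r := Algebra.TensorProduct.rid k k A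
      refine (h k (r.symm e) (he.map r.symm)).imp ?_ ?_ <;> intro h' <;>
        simpa using congrArg r h'
    have hB (e : B) (he : IsIdempotentElem e) : e = 0 ∨ e = 1 := by
      simpa using hA e (he.map B.val)
    have : IsArtinianRing B := .of_finite k B
    have : IsReduced B := FormallyUnramified.isReduced_of_field k B
    let _ : Field B := (IsArtinianRing.isField_of_forall_isIdempotentElem B hB).toField
    have : Algebra.IsSeparable k B := (FormallyEtale.iff_isSeparable k B).mp ‹_›
    exact B.range_val.symm.trans <| B.val.range_eq_bot_of_forall_isIdempotentElem (h B)
  · intro h L _ _ _ _ e he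
    cases subsingleton_or_nontrivial A
    · have : Subsingleton (A ⊗[k] L) := (Algebra.TensorProduct.includeLeftRingHom
        (R := k) (A := A) (B := L)).codomain_trivial
      exact .inl (Subsingleton.elim _ _)
    let b := Module.Free.chooseBasis k L
    set a := (Algebra.TensorProduct.basis A b).repr e with ha
    obtain ⟨hfin, het⟩ := finite_and_formallyEtale_adjoin_repr b he
    have hbot := h _ hfin het
    have hmem (i) : ∃ c : k, algebraMap k A c = a i :=
      Algebra.mem_bot.mp (hbot ▸ Algebra.subset_adjoin ⟨i, rfl⟩)
    choose c hc using hmem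
    let incl : L →ₐ[k] A ⊗[k] L := Algebra.TensorProduct.includeRight
    have hincl : Function.Injective incl :=
      Algebra.TensorProduct.includeRight_injective (algebraMap k A).injective
    have hey : e = incl (∑ i, c i • b i) := by
      rw [← (Algebra.TensorProduct.basis A b).sum_repr e, map_sum]
      refine Finset.sum_congr rfl fun i _ ↦ ?_
      rw [← ha, ← hc i]
      simp [incl]
    rw [hey] at he ⊢
    have hy : IsIdempotentElem (∑ i, c i • b i) := hincl (by rw [map_mul]; exact he)
    exact (IsIdempotentElem.iff_eq_zero_or_one.mp hy).imp (fun h ↦ by rw [h, map_zero])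
      (fun h ↦ by rw [h, map_one])
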